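/- arXiv:2207.00051 — 3 statements merged into one kernel-verified Lean document; each statement's English description precedes it below -/
import Mathlib

section
/- Let S be a reflective numerical semigroup with genus g(S) = g ≥ 1 and multiplicity m(S) = a, and let r be the unique integer in {1, ..., a−1} with g ≡ r (mod a). Then S = ⟨A⟩ where A is the minimal generating set of S, and A = {a} ∪ ({g+1, ..., g+(a−1)} \ {g+(a−r)}) if g ≢ −1 (mod a), while A = {a, 2g+1} ∪ {g+2, ..., g+(a−1)} if g ≡ −1 (mod a). -/
/-- A numerical semigroup: a subset of ℕ containing 0, closed under addition,
with finite complement. -/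
def IsNumericalSemigroup (S : Set ℕ) : Prop :=
  0 ∈ S ∧ (∀ a ∈ S, ∀ b ∈ S, a + b ∈ S) ∧ Sᶜ.Finite

/-- The genus: number of gaps. -/
noncomputable def genus (S : Set ℕ) : ℕ := Sᶜ.ncard

/-- The Frobenius number: the largest gap. -/
noncomputable def frob (S : Set ℕ) : ℕ := sSup Sᶜ

/-- The multiplicity: the smallest positive element. -/
noncomputable def mult (S : Set ℕ) : ℕ := sInf {n ∈ S | 0 < n}

/-- A numerical semigroup is reflective if for each z ∈ {0,...,g-1}
exactly one of z and z + g lies in S, where g is the genus. -/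
def Reflective (S : Set ℕ) : Prop :=
  ∀ z < genus S, Xor' (z ∈ S) (z + genus S ∈ S)

/-- A set A is equidistributed modulo m if each residue class mod m contains
the same number of elements of A. -/
def Equidistributed (A : Set ℕ) (m : ℕ) : Prop :=
  ∀ r₁ < m, ∀ r₂ < m, {x ∈ A | x % m = r₁}.ncard = {x ∈ A | x % m = r₂}.ncard

/-- The submonoid of ℕ generated by A. -/
def gen (A : Set ℕ) : Set ℕ := (AddSubmonoid.closure A : Set ℕ)

/-- The (unique) minimal generating set of a numerical semigroup: nonzero elements
not expressible as a sum of two nonzero elements. -/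
def minGens (S : Set ℕ) : Set ℕ :=
  {n ∈ S | n ≠ 0 ∧ ∀ a ∈ S, ∀ b ∈ S, a ≠ 0 → b ≠ 0 → n ≠ a + b}

/-- The embedding dimension: the cardinality of the minimal generating set. -/
noncomputable def embdim (S : Set ℕ) : ℕ := (minGens S).ncard

/-- The Apéry set of S relative to t: elements s of S with s - t ∉ S. -/
def aperySet (S : Set ℕ) (t : ℕ) : Set ℕ := {s ∈ S | ∀ u ∈ S, s ≠ u + t}

/-- Pseudo-Frobenius numbers: gaps h such that h + s ∈ S for every nonzero s ∈ S. -/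
def pseudoFrobenius (S : Set ℕ) : Set ℕ :=
  {h | h ∉ S ∧ ∀ s ∈ S, s ≠ 0 → h + s ∈ S}

/-- Membership of an integer in (the image in ℤ of) a numerical semigroup. -/
def memZ (S : Set ℕ) (z : ℤ) : Prop := 0 ≤ z ∧ z.toNat ∈ S

/-- Symmetric numerical semigroup. -/
def IsSymmetricNS (S : Set ℕ) : Prop :=
  ∀ z : ℤ, Xor' (memZ S z) (memZ S ((frob S : ℤ) - z))

/-- Pseudo-symmetric numerical semigroup. -/
def IsPseudoSymmetricNS (S : Set ℕ) : Prop :=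
  2 ∣ frob S ∧ ∀ z : ℤ, z ≠ (frob S : ℤ) / 2 →
    Xor' (memZ S z) (memZ S ((frob S : ℤ) - z))

/-- Irreducible numerical semigroup. -/
def IsIrreducibleNS (S : Set ℕ) : Prop :=
  ¬ ∃ T₁ T₂ : Set ℕ, IsNumericalSemigroup T₁ ∧ IsNumericalSemigroup T₂ ∧
    S ⊂ T₁ ∧ S ⊂ T₂ ∧ S = T₁ ∩ T₂

/-- A telescopic sequence a₁,...,a_k (1-indexed) of positive integers. -/
def TelescopicSeq (a : ℕ → ℕ) (k : ℕ) : Prop :=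
  (∀ i ∈ Finset.Icc 1 k, 0 < a i) ∧
  ∀ j ∈ Finset.Icc 2 k,
    ((Finset.Icc 1 (j-1)).gcd a / (Finset.Icc 1 j).gcd a) * a j ∈
      gen (a '' Set.Icc 1 (j-1))

/-- A free numerical semigroup: one generated by (the underlying set of)
a telescopic sequence. -/
def IsFreeNS (S : Set ℕ) : Prop :=
  ∃ (k : ℕ) (a : ℕ → ℕ), TelescopicSeq a k ∧ S = gen (a '' Set.Icc 1 k)

theorem IsNumericalSemigroup.eq_gen_minGens {S : Set ℕ} (hS : IsNumericalSemigroup S) :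
    S = gen (minGens S) := by
  obtain ⟨h0, hadd, -⟩ := hS
  apply Set.Subset.antisymm
  · intro n
    induction n using Nat.strong_induction_on with
    | _ n ih =>
      intro hn
      by_cases hmin : n ∈ minGens S
      · exact AddSubmonoid.subset_closure hmin
      by_cases hn0 : n = 0
      · subst hn0
        exact AddSubmonoid.zero_mem _
      simp only [minGens, Set.mem_ofPred_eq, not_and, not_forall, not_not] at hmin
      obtain ⟨x, hx, y, hy, hx0, hy0, rfl⟩ := hmin hn hn0
      exact AddSubmonoid.add_mem _ (ih x (by omega) hx) (ih y (by omega) hy)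
  · let M : AddSubmonoid ℕ :=
      { carrier := S, zero_mem' := h0, add_mem' := fun {x y} hx hy => hadd x hx y hy }
    exact (AddSubmonoid.closure_le (S := M)).2 fun n hn => hn.1

theorem mult_mem {S : Set ℕ} (hS : IsNumericalSemigroup S) : mult S ∈ S ∧ 0 < mult S := by
  have hinf : Sᶜᶜ.Infinite := hS.2.2.infinite_compl
  rw [compl_compl] at hinf
  obtain ⟨n, hn, hpos⟩ := hinf.exists_gt 0
  exact Nat.sInf_mem (s := {n ∈ S | 0 < n}) ⟨n, hn, hpos⟩

theorem mult_le {S : Set ℕ} {n : ℕ} (hn : n ∈ S) (hpos : 0 < n) : mult S ≤ n :=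
  Nat.sInf_le (show n ∈ {n ∈ S | 0 < n} from ⟨hn, hpos⟩)

theorem Reflective.add_genus_mem_iff_notMem {S : Set ℕ} (hrefl : Reflective S) {z : ℕ}
    (hz : z < genus S) : z + genus S ∈ S ↔ z ∉ S := by
  have h : Xor (z ∈ S) (z + genus S ∈ S) := hrefl z hz
  rw [xor_iff_not_iff] at h
  tauto

theorem Reflective.mem_of_two_mul_genus_le {S : Set ℕ} (hS : IsNumericalSemigroup S)
    (hrefl : Reflective S) {n : ℕ} (hn : 2 * genus S ≤ n) : n ∈ S := by
  classical
  let f : ℕ → ℕ := fun z => if z ∈ S then z + genus S else z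
  have himage : f '' Set.Iio (genus S) ⊆ Sᶜ := by
    rintro _ ⟨z, hz, rfl⟩
    have hz' := hrefl.add_genus_mem_iff_notMem hz
    by_cases hzS : z ∈ S
    · simp_all [f]
    · simp [f, hzS]
  have hinj : Set.InjOn f (Set.Iio (genus S)) := by
    intro x hx y hy hxy
    simp only [Set.mem_Iio] at hx hy
    simp only [f] at hxy
    split_ifs at hxy <;> omega
  have heq : f '' Set.Iio (genus S) = Sᶜ := by
    apply Set.eq_of_subset_of_ncard_le himage _ hS.2.2
    rw [hinj.ncard_image]
    simp [genus, Set.ncard_eq_toFinset_card']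
  by_contra hnS
  have hmem : n ∈ f '' Set.Iio (genus S) := heq ▸ hnS
  obtain ⟨z, hz, hzn⟩ := hmem
  simp only [Set.mem_Iio] at hz
  simp only [f] at hzn
  split_ifs at hzn <;> omega

theorem IsNumericalSemigroup.mem_of_mult_dvd {S : Set ℕ} (hS : IsNumericalSemigroup S) {n : ℕ}
    (hn : mult S ∣ n) : n ∈ S := by
  obtain ⟨k, rfl⟩ := hn
  induction k with
  | zero => simpa using hS.1
  | succ k ih => exact hS.2.1 _ ih _ (mult_mem hS).1

theorem Reflective.mult_dvd_of_mem {S : Set ℕ} (hS : IsNumericalSemigroup S)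
    (hrefl : Reflective S) {n : ℕ} (hlt : n < genus S) (hn : n ∈ S) : mult S ∣ n := by
  induction n using Nat.strong_induction_on with
  | _ n ih =>
    rcases Nat.eq_zero_or_pos n with rfl | hpos
    · exact dvd_zero _
    have hle := mult_le hn hpos
    obtain ⟨hmem, hmpos⟩ := mult_mem hS
    by_cases hsub : n - mult S ∈ S
    · have hdvd := dvd_add (ih _ (by omega) (by omega) hsub) dvd_rfl
      rwa [Nat.sub_add_cancel hle] at hdvd
    · have hshift : n - mult S + genus S ∈ S :=
        (hrefl.add_genus_mem_iff_notMem (by omega)).2 hsub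
      have hadd := hS.2.1 _ hshift _ hmem
      rw [show n - mult S + genus S + mult S = n + genus S by omega] at hadd
      exact absurd hn ((hrefl.add_genus_mem_iff_notMem hlt).1 hadd)

theorem Reflective.add_genus_mem_iff {S : Set ℕ} (hS : IsNumericalSemigroup S)
    (hrefl : Reflective S) {n : ℕ} (hlt : n < genus S) :
    n + genus S ∈ S ↔ ¬ mult S ∣ n := by
  rw [hrefl.add_genus_mem_iff_notMem hlt]
  exact not_congr ⟨hrefl.mult_dvd_of_mem hS hlt, hS.mem_of_mult_dvd⟩

theorem stmt6 (S : Set ℕ) (hS : IsNumericalSemigroup S) (hrefl : Reflective S)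
    (g a r : ℕ) (hg : genus S = g) (hg1 : 1 ≤ g) (ha : mult S = a)
    (hr1 : 1 ≤ r) (hr2 : r ≤ a - 1) (hmod : g % a = r) :
    S = gen (minGens S) ∧
    (¬ a ∣ (g + 1) →
      minGens S = {a} ∪ (Set.Icc (g + 1) (g + (a - 1)) \ {g + (a - r)})) ∧
    (a ∣ (g + 1) →
      minGens S = {a, 2 * g + 1} ∪ Set.Icc (g + 2) (g + (a - 1))) := by
  refine ⟨hS.eq_gen_minGens, ?_⟩
  have hlarge : ∀ n, 2 * g ≤ n → n ∈ S := fun n hn =>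
    hrefl.mem_of_two_mul_genus_le hS (by omega)
  have hmid : ∀ n, n < g → (n + g ∈ S ↔ ¬ a ∣ n) := fun n hn => by
    subst hg ha
    exact hrefl.add_genus_mem_iff hS hn
  have hgS : g ∉ S := by simpa using (hmid 0 hg1)
  have hsmall : ∀ n, n ≤ g → n ∈ S → a ∣ n := fun n hn hnS => by
    have hne : n ≠ g := fun h => hgS (h ▸ hnS)
    subst hg ha
    exact hrefl.mult_dvd_of_mem hS (by omega) hnS
  obtain ⟨haS, hapos⟩ : a ∈ S ∧ 0 < a := ha ▸ mult_mem hS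
  have hale : ∀ n ∈ S, n ≠ 0 → a ≤ n := fun n hn h0 =>
    ha ▸ mult_le hn (Nat.pos_of_ne_zero h0)
  have hwindow : ∀ j, 1 ≤ j → j ≤ a - 1 → j + g ∈ S := fun j hj1 hj2 => by
    rcases lt_or_ge j g with h | h
    · exact (hmid j h).2 (Nat.not_dvd_of_pos_of_lt hj1 (by omega))
    · exact hlarge _ (by omega)
  have hdvd_iff : ∀ n, g + 1 ≤ n → n ≤ g + (a - 1) → (a ∣ n ↔ n = g + (a - r)) := by
    have hmul : a ∣ g + (a - r) := by
      have hdiv := Nat.div_add_mod g a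
      exact ⟨g / a + 1, by rw [mul_add, mul_one]; omega⟩
    intro n h1 h2
    refine ⟨fun h => ?_, fun h => h ▸ hmul⟩
    have hmodEq : n ≡ g + (a - r) [MOD a] :=
      (Nat.modEq_zero_iff_dvd.2 h).trans (Nat.modEq_zero_iff_dvd.2 hmul).symm
    exact hmodEq.eq_of_abs_lt (by rw [abs_lt]; constructor <;> push_cast <;> omega)
  have hmin_a : a ∈ minGens S := by
    refine ⟨haS, by omega, fun x hx y hy hx0 hy0 h => ?_⟩
    have := hale x hx hx0
    omega
  have hmin_window : ∀ n, g + 1 ≤ n → n ≤ g + (a - 1) → n ≠ g + (a - r) → n ∈ minGens S := by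
    intro n h1 h2 h3
    have hnS : n ∈ S := by
      have := hwindow (n - g) (by omega) (by omega)
      rwa [show n - g + g = n by omega] at this
    refine ⟨hnS, by omega, fun x hx y hy hx0 hy0 h => ?_⟩
    have hxa := hale x hx hx0
    have hya := hale y hy hy0
    apply h3
    rw [← hdvd_iff n h1 h2, h]
    exact dvd_add (hsmall x (by omega) hx) (hsmall y (by omega) hy)
  have hsub : ∀ n ∈ minGens S, n ≠ a → n - a ∉ S := by
    intro n hn hne hnS
    have := hale n hn.1 hn.2.1
    exact hn.2.2 (n - a) hnS a haS (by omega) (by omega) (by omega)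
  have hcases : ∀ n ∈ minGens S, n = a ∨
      (g + 1 ≤ n ∧ n ≤ g + (a - 1) ∧ n ≠ g + (a - r)) ∨ n = 2 * g + (a - r) := by
    intro n hn
    by_cases hna : n = a
    · exact Or.inl hna
    have hnot := hsub n hn hna
    have hndvd : ¬ a ∣ n := fun h => hnot (hS.mem_of_mult_dvd (by rw [ha]; exact Nat.dvd_sub h dvd_rfl))
    have hgn : g < n := by
      by_contra hle
      exact hndvd (hsmall n (by omega) hn.1)
    rcases le_or_gt n (g + (a - 1)) with hle | hgt
    · exact Or.inr (Or.inl ⟨hgn, hle, fun h => hndvd ((hdvd_iff n hgn hle).2 h)⟩)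
    · have hlt : n - a < 2 * g := by
        by_contra hge
        exact hnot (hlarge _ (by omega))
      have hdvd : a ∣ n - a - g := by
        by_contra hnd
        apply hnot
        have := (hmid (n - a - g) (by omega)).2 hnd
        rwa [show n - a - g + g = n - a by omega] at this
      have hdvd' : a ∣ n - g := by
        have := dvd_add hdvd (dvd_refl a)
        rwa [show n - a - g + a = n - g by omega] at this
      have hge : 2 * g ≤ n := by
        by_contra hlt'
        have := (hmid (n - g) (by omega)).1 (by rw [show n - g + g = n by omega]; exact hn.1)
        exact this hdvd'
      have hne : n - g ≠ g := by
        intro h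
        rw [h, Nat.dvd_iff_mod_eq_zero] at hdvd'
        omega
      have := (hdvd_iff (n - g) (by omega) (by omega)).1 hdvd'
      omega
  refine ⟨fun hnd => ?_, fun hd => ?_⟩
  · have hr : r ≠ a - 1 := by
      intro h
      exact hnd ((hdvd_iff (g + 1) le_rfl (by omega)).2 (by omega))
    ext n
    simp only [Set.mem_union, Set.mem_singleton_iff, Set.mem_sdiff, Set.mem_Icc]
    constructor
    · intro hn
      rcases hcases n hn with h | h | h
      · exact Or.inl h
      · exact Or.inr ⟨⟨h.1, h.2.1⟩, h.2.2⟩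
      · exact absurd (by omega) (hn.2.2 _ (hwindow 1 le_rfl (by omega)) _
          (hwindow (a - r - 1) (by omega) (by omega)) (by omega) (by omega))
    · rintro (rfl | ⟨⟨h1, h2⟩, h3⟩)
      · exact hmin_a
      · exact hmin_window n h1 h2 h3
  · have hr : r = a - 1 := by
      have := (hdvd_iff (g + 1) le_rfl (by omega)).1 hd
      omega
    have hmin_top : 2 * g + 1 ∈ minGens S := by
      have hnot_sum : ∀ x ∈ S, ∀ y ∈ S, x ≠ 0 → x ≤ g → 2 * g + 1 ≠ x + y := by
        intro x hx y hy hx0 hxg h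
        have hxa := hale x hx hx0
        have hdy : a ∣ g + 1 - x := Nat.dvd_sub hd (hsmall x hxg hx)
        refine (hmid (g + 1 - x) (by omega)).1 ?_ hdy
        rwa [show g + 1 - x + g = y by omega]
      refine ⟨hlarge _ (by omega), by omega, fun x hx y hy hx0 hy0 h => ?_⟩
      rcases le_or_gt x g with hxg | hxg
      · exact hnot_sum x hx y hy hx0 hxg h
      · exact hnot_sum y hy x hx hy0 (by omega) (by omega)
    ext n
    simp only [Set.mem_union, Set.mem_insert_iff, Set.mem_singleton_iff, Set.mem_Icc]
    constructor
    · intro hn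
      have := hcases n hn
      omega
    · rintro ((rfl | rfl) | ⟨h1, h2⟩)
      · exact hmin_a
      · exact hmin_top
      · exact hmin_window n (by omega) h2 (by omega)
end

section
/- Let S be a reflective numerical semigroup with genus g(S) = g ≥ 1 and multiplicity m(S) = a. Then: S is symmetric if and only if g ≡ 1 (mod a); S is pseudo-symmetric if and only if g ≡ 2 (mod a); and S is irreducible if and only if g ≡ 1 (mod a) or g ≡ 2 (mod a). -/
theorem memZ_natCast (S : Set ℕ) (n : ℕ) : memZ S (n : ℤ) ↔ n ∈ S := by
  simp [memZ]

theorem not_memZ_of_neg (S : Set ℕ) {z : ℤ} (hz : z < 0) : ¬ memZ S z :=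
  fun h => absurd h.1 (not_le.2 hz)

theorem mem_of_isGreatest_compl_lt {S : Set ℕ} {F n : ℕ} (hF : IsGreatest Sᶜ F) (h : F < n) :
    n ∈ S := by
  by_contra hn
  exact absurd (hF.2 hn) (not_le.2 h)

/-- Outside `[0, F]`, the reflection `z ↦ F - z` always exchanges members and non-members. -/
theorem xor_memZ_sub_of_forall {S : Set ℕ} {F : ℕ} (hF : IsGreatest Sᶜ F) (z : ℤ)
    (h : ∀ n m : ℕ, n + m = F → (n : ℤ) = z → Xor (n ∈ S) (m ∈ S)) :
    Xor (memZ S z) (memZ S ((F : ℤ) - z)) := by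
  rcases lt_or_ge z 0 with hz | hz
  · obtain ⟨m, hm⟩ := Int.eq_ofNat_of_zero_le (a := (F : ℤ) - z) (by omega)
    rw [hm]
    exact Or.inr ⟨(memZ_natCast S m).2 (mem_of_isGreatest_compl_lt hF (by omega)),
      not_memZ_of_neg S hz⟩
  obtain ⟨n, rfl⟩ := Int.eq_ofNat_of_zero_le hz
  rcases lt_or_ge F n with hn | hn
  · exact Or.inl ⟨(memZ_natCast S n).2 (mem_of_isGreatest_compl_lt hF hn),
      not_memZ_of_neg S (by omega)⟩
  · have := h n (F - n) (by omega) rfl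
    rwa [← Nat.cast_sub hn, memZ_natCast, memZ_natCast]

theorem isSymmetricNS_iff {S : Set ℕ} (hF : IsGreatest Sᶜ (frob S)) :
    IsSymmetricNS S ↔ ∀ n m : ℕ, n + m = frob S → Xor (n ∈ S) (m ∈ S) := by
  refine ⟨fun h n m hnm => ?_, fun h z => xor_memZ_sub_of_forall hF z fun n m hnm _ => h n m hnm⟩
  have := h n
  rwa [show (frob S : ℤ) - n = m by omega, memZ_natCast, memZ_natCast] at this

theorem isPseudoSymmetricNS_iff {S : Set ℕ} (hF : IsGreatest Sᶜ (frob S)) :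
    IsPseudoSymmetricNS S ↔
      2 ∣ frob S ∧ ∀ n m : ℕ, n + m = frob S → n ≠ m → Xor (n ∈ S) (m ∈ S) := by
  refine and_congr_right fun h2 => ⟨fun h n m hnm hne => ?_, fun h z hz =>
    xor_memZ_sub_of_forall hF z fun n m hnm hn => h n m hnm (by omega)⟩
  have := h n (by omega)
  rwa [show (frob S : ℤ) - n = m by omega, memZ_natCast, memZ_natCast] at this

theorem isIrreducibleNS_of_forall_xor {S : Set ℕ} {F : ℕ} (hF : IsGreatest Sᶜ F)
    (h : ∀ n m : ℕ, n + m = F → n ≠ m → Xor (n ∈ S) (m ∈ S)) : IsIrreducibleNS S := by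
  have key : ∀ T : Set ℕ, IsNumericalSemigroup T → S ⊂ T → F ∈ T := by
    intro T hT hST
    obtain ⟨x, hxT, hxS⟩ := Set.exists_of_ssubset hST
    obtain ⟨y, rfl⟩ := Nat.exists_eq_add_of_le (hF.2 hxS)
    refine hT.2.1 x hxT y ?_
    by_cases hxy : x = y
    · exact hxy ▸ hxT
    · rcases h x y rfl hxy with h | h
      · exact absurd h.1 hxS
      · exact hST.1 h.1
  rintro ⟨T₁, T₂, hT₁, hT₂, h₁, h₂, h₁₂⟩
  exact hF.1 (h₁₂ ▸ ⟨key T₁ hT₁ h₁, key T₂ hT₂ h₂⟩)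

theorem IsNumericalSemigroup.insert {S : Set ℕ} (hS : IsNumericalSemigroup S) {x : ℕ}
    (hx : ∀ s ∈ S, s ≠ 0 → x + s ∈ S) (hxx : x + x ∈ S) :
    IsNumericalSemigroup (Insert.insert x S) := by
  have key : ∀ s ∈ S, x + s ∈ Insert.insert x S := by
    intro s hs
    rcases eq_or_ne s 0 with rfl | h0
    · exact Or.inl rfl
    · exact Or.inr (hx s hs h0)
  refine ⟨Or.inr hS.1, ?_, hS.2.2.subset (Set.compl_subset_compl.2 (Set.subset_insert x S))⟩
  rintro u (rfl | hu) v (rfl | hv)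
  · exact Or.inr hxx
  · exact key v hv
  · exact add_comm v u ▸ key u hu
  · exact Or.inr (hS.2.1 u hu v hv)

/-- Two distinct pseudo-Frobenius numbers whose doubles lie in `S` witness reducibility. -/
theorem not_isIrreducibleNS_of_pseudoFrobenius {S : Set ℕ} (hS : IsNumericalSemigroup S)
    {x y : ℕ} (hxy : x ≠ y) (hx : x ∈ pseudoFrobenius S) (hy : y ∈ pseudoFrobenius S)
    (hxx : x + x ∈ S) (hyy : y + y ∈ S) : ¬ IsIrreducibleNS S := by
  refine not_not.2 ⟨_, _, hS.insert hx.2 hxx, hS.insert hy.2 hyy, Set.ssubset_insert hx.1,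
    Set.ssubset_insert hy.1, ?_⟩
  ext n
  simp only [Set.mem_inter_iff, Set.mem_insert_iff]
  constructor
  · exact fun h => ⟨Or.inr h, Or.inr h⟩
  · rintro ⟨rfl | h, rfl | h'⟩
    · exact absurd rfl hxy
    all_goals assumption

theorem Reflective.lt_two_mul_genus {S : Set ℕ} (hrefl : Reflective S)
    (hfin : Sᶜ.Finite) {n : ℕ} (hn : n ∉ S) : n < 2 * genus S := by
  classical
  let f : ℕ → ℕ := fun z => if z ∈ S then z + genus S else z
  have hinj : Set.InjOn f (Finset.range (genus S)) := by
    intro x hx y hy hxy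
    simp only [Finset.coe_range, Set.mem_Iio] at hx hy
    simp only [f] at hxy
    split_ifs at hxy <;> omega
  have hsub : (Finset.range (genus S)).image f ⊆ hfin.toFinset := by
    intro y hy
    obtain ⟨z, hz, rfl⟩ := Finset.mem_image.1 hy
    simp only [Set.Finite.mem_toFinset, Set.mem_compl_iff, f]
    rcases hrefl z (Finset.mem_range.1 hz) with h | h
    · simpa [h.1] using h.2
    · simp [h.2]
  have heq := Finset.eq_of_subset_of_card_le hsub (by
    rw [Finset.card_image_of_injOn hinj, Finset.card_range, genus,
      Set.ncard_eq_toFinset_card _ hfin])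
  have hmem : n ∈ (Finset.range (genus S)).image f := heq ▸ hfin.mem_toFinset.2 hn
  obtain ⟨z, hz, rfl⟩ := Finset.mem_image.1 hmem
  have := Finset.mem_range.1 hz
  simp only [f]
  split_ifs <;> omega

theorem IsNumericalSemigroup.mem_of_dvd {S : Set ℕ} (hS : IsNumericalSemigroup S) {a n : ℕ}
    (ha : a ∈ S) (h : a ∣ n) : n ∈ S := by
  obtain ⟨k, rfl⟩ := h
  induction k with
  | zero => simpa using hS.1
  | succ k ih => exact hS.2.1 _ ih _ ha

/-- A reflective numerical semigroup is determined by its genus and multiplicity. -/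
theorem Reflective.mem_iff {S : Set ℕ} (hS : IsNumericalSemigroup S) (hrefl : Reflective S)
    (hg : 1 ≤ genus S) (n : ℕ) :
    n ∈ S ↔ n < genus S ∧ mult S ∣ n ∨
      genus S ≤ n ∧ (2 * genus S ≤ n ∨ ¬ mult S ∣ n - genus S) := by
  have hbig : ∀ n, 2 * genus S ≤ n → n ∈ S := fun n h => by
    by_contra hn
    exact absurd (hrefl.lt_two_mul_genus hS.2.2 hn) (not_lt.2 h)
  have hne : {n ∈ S | 0 < n}.Nonempty := ⟨2 * genus S, hbig _ le_rfl, by omega⟩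
  obtain ⟨haS, ha0⟩ : mult S ∈ S ∧ 0 < mult S := Nat.sInf_mem hne
  have hmin : ∀ i, 0 < i → i < mult S → i ∉ S := fun i h0 hi hiS =>
    absurd (Nat.sInf_le (s := {n ∈ S | 0 < n}) ⟨hiS, h0⟩) (not_le.2 hi)
  have hgap : ∀ n, genus S ≤ n → n ∉ S → mult S ∣ n - genus S := by
    intro n
    induction n using Nat.strong_induction_on with
    | _ n ih =>
      intro hn hnS
      rcases lt_or_ge n (genus S + mult S) with hlt | hge
      · have hn2 := hrefl.lt_two_mul_genus hS.2.2 hnS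
        rcases Nat.eq_zero_or_pos (n - genus S) with h0 | h0
        · simp [h0]
        · rcases hrefl (n - genus S) (by omega) with h | h
          · exact absurd h.1 (hmin _ h0 (by omega))
          · exact absurd (Nat.sub_add_cancel hn ▸ h.1) hnS
      · have hprev : n - mult S ∉ S := fun h =>
          hnS (Nat.sub_add_cancel (show mult S ≤ n by omega) ▸ hS.2.1 _ h _ haS)
        have := (ih (n - mult S) (by omega) (by omega) hprev).add (dvd_refl (mult S))
        rwa [show n - mult S - genus S + mult S = n - genus S by omega] at this
  rcases lt_or_ge n (genus S) with hlt | hge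
  · refine ⟨fun h => Or.inl ⟨hlt, ?_⟩, fun h => ?_⟩
    · have hn : n + genus S ∉ S := by
        rcases hrefl n hlt with h' | h'
        · exact h'.2
        · exact absurd h h'.2
      simpa using hgap _ (Nat.le_add_left _ _) hn
    · exact hS.mem_of_dvd haS (h.resolve_right (fun h => by omega)).2
  · refine ⟨fun h => Or.inr ⟨hge, or_iff_not_imp_left.2 fun h2 hd => ?_⟩, fun h => ?_⟩
    · rcases hrefl (n - genus S) (by omega) with h' | h'
      · exact h'.2 (by rwa [Nat.sub_add_cancel hge])
      · exact h'.2 (hS.mem_of_dvd haS hd)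
    · rcases h with h | ⟨-, h | h⟩
      · omega
      · exact hbig n h
      · by_contra hn
        exact h (hgap n hge hn)

theorem Reflective.not_mult_dvd_genus {S : Set ℕ} (hS : IsNumericalSemigroup S)
    (hrefl : Reflective S) (hg : 1 ≤ genus S) : ¬ mult S ∣ genus S := by
  intro h
  have hgS : genus S ∉ S := by
    rcases hrefl 0 hg with h' | h'
    · simpa using h'.2
    · exact absurd hS.1 h'.2
  have hmS : mult S ∈ S := by
    refine (Nat.sInf_mem (s := {n ∈ S | 0 < n}) ⟨2 * genus S, ?_, by omega⟩).1
    exact (hrefl.mem_iff hS hg _).2 (by omega)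
  exact hgS (hS.mem_of_dvd hmS h)

theorem Reflective.isGreatest_compl {S : Set ℕ} (hS : IsNumericalSemigroup S)
    (hrefl : Reflective S) (hg : 1 ≤ genus S) :
    IsGreatest Sᶜ (2 * genus S - genus S % mult S) := by
  have hnd := hrefl.not_mult_dvd_genus hS hg
  have hr : 0 < genus S % mult S := Nat.pos_of_ne_zero fun h => hnd (Nat.dvd_of_mod_eq_zero h)
  have hle := Nat.mod_le (genus S) (mult S)
  constructor
  · rw [Set.mem_compl_iff, hrefl.mem_iff hS hg]
    have hd : mult S ∣ 2 * genus S - genus S % mult S - genus S := by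
      rw [show 2 * genus S - genus S % mult S - genus S = genus S - genus S % mult S by omega]
      exact Nat.dvd_sub_mod _
    rintro (h | ⟨-, h | h⟩)
    · omega
    · omega
    · exact h hd
  · intro n hn
    rw [Set.mem_compl_iff, hrefl.mem_iff hS hg] at hn
    by_contra hlt
    have hd : mult S ∣ n - genus S := by
      by_contra h
      exact hn (Or.inr ⟨by omega, Or.inr h⟩)
    have hn2 : n < 2 * genus S := by
      by_contra h
      exact hn (Or.inr ⟨by omega, Or.inl (by omega)⟩)
    obtain ⟨k, hk⟩ := hd
    have hq := Nat.div_add_mod (genus S) (mult S)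
    have h₁ : mult S * (genus S / mult S) < mult S * k := by omega
    have h₂ : mult S * k < mult S * (genus S / mult S + 1) := by
      have := Nat.lt_mul_div_succ (genus S) (b := mult S)
        (Nat.pos_of_ne_zero fun h => by simp [h] at h₁)
      omega
    have := Nat.lt_of_mul_lt_mul_left h₁
    have := Nat.lt_of_mul_lt_mul_left h₂
    omega

theorem stmt11 (S : Set ℕ) (hS : IsNumericalSemigroup S) (hrefl : Reflective S)
    (g a : ℕ) (hg : genus S = g) (hg1 : 1 ≤ g) (ha : mult S = a) :
    (IsSymmetricNS S ↔ g ≡ 1 [MOD a]) ∧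
    (IsPseudoSymmetricNS S ↔ g ≡ 2 [MOD a]) ∧
    (IsIrreducibleNS S ↔ (g ≡ 1 [MOD a] ∨ g ≡ 2 [MOD a])) := by
  subst hg ha
  have hmem := hrefl.mem_iff hS hg1
  have hnd := hrefl.not_mult_dvd_genus hS hg1
  have hG := hrefl.isGreatest_compl hS hg1
  have hfrob : frob S = 2 * genus S - genus S % mult S := hG.csSup_eq
  have ha0 : 0 < mult S := Nat.pos_of_ne_zero fun h => by
    have := (hmem (2 * genus S)).2 (by omega)
    have := Nat.sInf_mem (s := {n ∈ S | 0 < n}) ⟨2 * genus S, this, by omega⟩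
    exact absurd h this.2.ne'
  generalize genus S = g at *
  generalize mult S = a at *
  have hq := Nat.div_add_mod g a
  have hra := Nat.mod_lt g ha0
  have hr : 0 < g % a := Nat.pos_of_ne_zero fun h => hnd (Nat.dvd_of_mod_eq_zero h)
  have e1 : g ≡ 1 [MOD a] ↔ g % a = 1 := by
    rw [Nat.ModEq, Nat.mod_eq_of_lt (show 1 < a by omega)]
  have e2 : g ≡ 2 [MOD a] ↔ g % a = 2 := by
    rcases (show a = 2 ∨ 2 < a by omega) with rfl | h
    · rw [Nat.ModEq]
      omega
    · rw [Nat.ModEq, Nat.mod_eq_of_lt h]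
  have hF : IsGreatest Sᶜ (frob S) := hfrob ▸ hG
  rw [e1, e2, isSymmetricNS_iff hF, isPseudoSymmetricNS_iff hF]
  generalize g / a = q at *
  generalize g % a = r at *
  have hndvd : ∀ k i, 0 < i → i < a → ¬ a ∣ a * k + i := fun k i h0 hi hd =>
    absurd (Nat.le_of_dvd h0 ((Nat.dvd_add_right (dvd_mul_right a k)).1 hd)) (not_le.2 hi)
  have hxor : ∀ n m, n + m = 2 * g - r → n ≤ a * q → Xor (n ∈ S) (m ∈ S) := by
    intro n m hnm hn
    have hdvd : a ∣ m - g ↔ a ∣ n := by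
      rw [show m - g = a * q - n by omega]
      exact Nat.dvd_sub_iff_right hn (dvd_mul_right a q)
    have hn' := hmem n
    have hm' := hmem m
    rw [hdvd] at hm'
    by_cases h : a ∣ n
    · exact Or.inl ⟨hn'.2 (Or.inl ⟨by omega, h⟩), fun hm => by
        rcases hm'.1 hm with hm | ⟨-, hm | hm⟩
        · omega
        · omega
        · exact hm h⟩
    · exact Or.inr ⟨hm'.2 (Or.inr ⟨by omega, Or.inr h⟩), fun hn => by
        rcases hn'.1 hn with hn | hn
        · exact h hn.2
        · omega⟩
  have hpred : 2 ≤ r → g - 1 ∉ S := fun h2 h => by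
    rcases (hmem _).1 h with h | h
    · exact hndvd q (r - 1) (by omega) (by omega)
        (by rw [show a * q + (r - 1) = g - 1 by omega]; exact h.2)
    · omega
  have hsucc : 2 ≤ r → a * q + 1 ∉ S := fun h2 h => by
    rcases (hmem _).1 h with h | h
    · exact hndvd q 1 (by omega) (by omega) h.2
    · omega
  have hnot : 2 ≤ r → ¬ Xor (g - 1 ∈ S) (a * q + 1 ∈ S) := fun h2 h =>
    h.elim (fun h => hpred h2 h.1) (fun h => hsucc h2 h.1)
  have hpseudo : r = 1 ∨ r = 2 → ∀ n m, n + m = frob S → n ≠ m → Xor (n ∈ S) (m ∈ S) := by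
    intro hr' n m hnm hne
    rcases lt_or_gt_of_ne hne with h | h
    · exact hxor n m (by omega) (by omega)
    · exact (hxor m n (by omega) (by omega)).symm
  have hred : 3 ≤ r → ¬ IsIrreducibleNS S := by
    intro h3
    have hgS : g ∉ S := fun h => by
      rcases (hmem _).1 h with h | ⟨-, h | h⟩
      · omega
      · omega
      · exact h (by simp)
    have hpos : ∀ s ∈ S, s ≠ 0 → s < g ∧ a ∣ s ∧ a ≤ s ∨ g < s := by
      intro s hs h0
      rcases lt_trichotomy s g with h | rfl | h
      · rcases (hmem _).1 hs with h' | h'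
        · exact Or.inl ⟨h, h'.2, Nat.le_of_dvd (by omega) h'.2⟩
        · omega
      · exact absurd hs hgS
      · exact Or.inr h
    refine not_isIrreducibleNS_of_pseudoFrobenius hS (x := g - 1) (y := 2 * g - r) (by omega)
      ⟨hpred (by omega), fun s hs h0 => (hmem _).2 (Or.inr ?_)⟩
      ⟨hG.1, fun s hs h0 => (hmem _).2 (Or.inr ?_)⟩ ((hmem _).2 (Or.inr ?_))
      ((hmem _).2 (Or.inr ?_))
    · rcases hpos s hs h0 with ⟨-, ⟨t, rfl⟩, h⟩ | h
      · refine ⟨by omega, Or.inr ?_⟩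
        obtain ⟨t, rfl⟩ := Nat.exists_eq_succ_of_ne_zero (right_ne_zero_of_mul h0)
        rw [Nat.mul_succ, show g - 1 + (a * t + a) - g = a * t + (a - 1) by omega]
        exact hndvd _ _ (by omega) (by omega)
      · omega
    · rcases hpos s hs h0 with h | h <;> omega
    · refine ⟨by omega, Or.inr ?_⟩
      rw [show g - 1 + (g - 1) - g = a * q + (r - 2) by omega]
      exact hndvd _ _ (by omega) (by omega)
    · omega
  refine ⟨⟨fun h => ?_, fun h1 n m hnm => ?_⟩, ⟨fun ⟨h2, h⟩ => ?_, fun h2 => ⟨by omega, ?_⟩⟩,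
    fun h => ?_, fun h => isIrreducibleNS_of_forall_xor hF (hpseudo h)⟩
  · by_contra h1
    exact hnot (by omega) (h _ _ (by omega))
  · exact hpseudo (Or.inl h1) n m hnm (by omega)
  · by_contra h2'
    exact hnot (by omega) (h _ _ (by omega) (by omega))
  · exact hpseudo (Or.inr h2)
  · by_contra h'
    exact hred (by omega) h
end

section
/- Suppose S is a reflective numerical semigroup with genus g(S) = g ≥ 1 and Frobenius number F(S). Then the embedding dimension satisfies e(S) ≥ (F(S) + 1)/(F(S) + 1 − g); that is, S satisfies Wilf's conjecture. -/
theorem IsNumericalSemigroup.le_frob {S : Set ℕ} (hS : IsNumericalSemigroup S) {x : ℕ}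
    (hx : x ∉ S) : x ≤ frob S :=
  le_csSup hS.2.2.bddAbove hx

theorem IsNumericalSemigroup.mem_of_frob_lt {S : Set ℕ} (hS : IsNumericalSemigroup S) {x : ℕ}
    (hx : frob S < x) : x ∈ S := by
  by_contra h
  exact absurd (hS.le_frob h) (by omega)

theorem IsNumericalSemigroup.mul_mem {S : Set ℕ} (hS : IsNumericalSemigroup S) {s : ℕ}
    (hs : s ∈ S) (k : ℕ) : s * k ∈ S := by
  induction k with
  | zero => simpa using hS.1
  | succ k ih => exact hS.2.1 _ ih _ hs

theorem IsNumericalSemigroup.one_notMem {S : Set ℕ} (hS : IsNumericalSemigroup S)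
    (hg : 1 ≤ genus S) : 1 ∉ S := by
  intro h1
  have : Sᶜ = ∅ := by
    ext x
    simpa using hS.mul_mem h1 x
  simp [genus, this] at hg

theorem IsNumericalSemigroup.compl_subset_Icc {S : Set ℕ} (hS : IsNumericalSemigroup S) :
    Sᶜ ⊆ Set.Icc 1 (frob S) := fun _ hx =>
  ⟨Nat.one_le_iff_ne_zero.2 fun h => hx (h ▸ hS.1), hS.le_frob hx⟩

theorem IsNumericalSemigroup.genus_le_frob {S : Set ℕ} (hS : IsNumericalSemigroup S) :
    genus S ≤ frob S := by
  simpa [genus] using Set.ncard_le_ncard hS.compl_subset_Icc (Set.finite_Icc _ _)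

theorem IsNumericalSemigroup.finite_minGens {S : Set ℕ} (hS : IsNumericalSemigroup S) :
    (minGens S).Finite := by
  refine (Set.finite_Iio (2 * (frob S + 1))).subset fun n hn => ?_
  by_contra h
  simp only [Set.mem_Iio, not_lt] at h
  exact hn.2.2 (frob S + 1) (hS.mem_of_frob_lt (by omega)) (n - (frob S + 1))
    (hS.mem_of_frob_lt (by omega)) (by omega) (by omega) (by omega)

theorem IsNumericalSemigroup.mem_iff_mem_closure_minGens {S : Set ℕ}
    (hS : IsNumericalSemigroup S) (n : ℕ) : n ∈ S ↔ n ∈ AddSubmonoid.closure (minGens S) := by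
  constructor
  · induction n using Nat.strong_induction_on with
    | _ n ih =>
      intro hn
      rcases eq_or_ne n 0 with rfl | h0
      · exact zero_mem _
      by_cases hm : n ∈ minGens S
      · exact AddSubmonoid.subset_closure hm
      · have : ∃ a ∈ S, ∃ b ∈ S, a ≠ 0 ∧ b ≠ 0 ∧ n = a + b := by
          by_contra! h
          exact hm ⟨hn, h0, h⟩
        obtain ⟨a, ha, b, hb, ha0, hb0, rfl⟩ := this
        exact add_mem (ih a (by omega) ha) (ih b (by omega) hb)
  · intro h
    induction h using AddSubmonoid.closure_induction with
    | mem x hx => exact hx.1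
    | zero => exact hS.1
    | add x y _ _ hx hy => exact hS.2.1 _ hx _ hy

theorem IsNumericalSemigroup.coprime_of_mem_iff_mem_closure_pair {S : Set ℕ}
    (hS : IsNumericalSemigroup S) {p q : ℕ}
    (h : ∀ n, n ∈ S ↔ n ∈ AddSubmonoid.closure {p, q}) : p.Coprime q := by
  have key : ∀ n ∈ S, p.gcd q ∣ n := by
    intro n hn
    obtain ⟨a, b, rfl⟩ := (AddSubmonoid.mem_closure_pair _ _ _).1 ((h n).1 hn)
    simp only [smul_eq_mul]
    exact dvd_add ((Nat.gcd_dvd_left p q).mul_left a) ((Nat.gcd_dvd_right p q).mul_left b)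
  have h1 := key (frob S + 1) (hS.mem_of_frob_lt (by omega))
  have h2 := key (frob S + 1 + 1) (hS.mem_of_frob_lt (by omega))
  exact Nat.dvd_one.1 ((Nat.dvd_add_right h1).1 h2)

/-- A gap `x` of `⟨p, q⟩` reflects to the element `pq - p - q - x`. -/
theorem exists_mul_add_mul_of_notMem_closure_pair {p q x : ℕ} (hp : 1 < p)
    (hpq : p.Coprime q) (hx : x ∉ AddSubmonoid.closure {p, q}) :
    ∃ a b : ℕ, x + (a * p + b * q) + p + q = p * q := by
  obtain ⟨u, v, huv, hv0, hvp⟩ : ∃ u v : ℤ, (x : ℤ) = u * p + v * q ∧ 0 ≤ v ∧ v < p := by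
    have hb := Nat.gcd_eq_gcd_ab p q
    rw [hpq.gcd_eq_one] at hb
    set w : ℤ := x * p.gcdB q
    refine ⟨x * p.gcdA q + w / p * q, w % p, ?_, Int.emod_nonneg _ (by omega),
      Int.emod_lt_of_pos _ (by omega)⟩
    have hw := Int.emod_add_mul_ediv w p
    push_cast at hb
    linear_combination (x : ℤ) * hb - (q : ℤ) * hw
  have hu : u < 0 := by
    by_contra! hu
    lift u to ℕ using hu
    lift v to ℕ using hv0
    exact hx ((AddSubmonoid.mem_closure_pair _ _ _).2 ⟨u, v, by
      simp only [smul_eq_mul]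
      exact_mod_cast huv.symm⟩)
  obtain ⟨a, ha⟩ := Int.eq_ofNat_of_zero_le (show 0 ≤ -u - 1 by omega)
  obtain ⟨b, hb⟩ := Int.eq_ofNat_of_zero_le (show 0 ≤ p - 1 - v by omega)
  refine ⟨a, b, ?_⟩
  zify
  rw [← ha, ← hb, huv]
  ring

theorem IsNumericalSemigroup.two_mul_genus_le_of_mem_iff_mem_closure_pair {S : Set ℕ}
    (hS : IsNumericalSemigroup S) {p q : ℕ}
    (h : ∀ n, n ∈ S ↔ n ∈ AddSubmonoid.closure {p, q}) (hp : 1 < p) (hq : 1 < q) :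
    2 * genus S ≤ frob S + 1 := by
  have hpq := hS.coprime_of_mem_iff_mem_closure_pair h
  have hK : p * q - p - q ≤ frob S :=
    hS.le_frob fun hK => (frobeniusNumber_pair hpq hp hq).1 ((h _).1 hK)
  have hinj : Sᶜ.ncard ≤ (Set.Iic (frob S) \ Sᶜ).ncard := by
    refine Set.ncard_le_ncard_of_injOn (fun x => p * q - p - q - x) ?_ ?_
      ((Set.finite_Iic _).subset Set.sdiff_subset)
    · intro x hx
      obtain ⟨a, b, hab⟩ := exists_mul_add_mul_of_notMem_closure_pair hp hpq (mt (h x).2 hx)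
      refine ⟨(Nat.sub_le _ _).trans hK, fun hn => hn ?_⟩
      refine (h _).2 ((AddSubmonoid.mem_closure_pair _ _ _).2 ⟨a, b, ?_⟩)
      simp only [smul_eq_mul]
      omega
    · intro x hx y hy hxy
      obtain ⟨a, b, hab⟩ := exists_mul_add_mul_of_notMem_closure_pair hp hpq (mt (h x).2 hx)
      obtain ⟨c, d, hcd⟩ := exists_mul_add_mul_of_notMem_closure_pair hp hpq (mt (h y).2 hy)
      simp only at hxy
      omega
  have hsum := Set.ncard_sdiff_add_ncard_of_subset
    (show Sᶜ ⊆ Set.Iic (frob S) from fun _ hx => hS.le_frob hx) (Set.finite_Iic _)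
  rw [Set.ncard_Iic_nat] at hsum
  unfold genus
  omega

theorem IsNumericalSemigroup.two_le_embdim {S : Set ℕ} (hS : IsNumericalSemigroup S)
    (hg : 1 ≤ genus S) : 2 ≤ embdim S := by
  have h1 := hS.one_notMem hg
  by_contra! hlt
  have hcl := hS.mem_iff_mem_closure_minGens
  rcases (show embdim S = 0 ∨ embdim S = 1 by omega) with h0 | h0
  · rw [(Set.ncard_eq_zero hS.finite_minGens).1 h0] at hcl
    simpa using (hcl (frob S + 1)).1 (hS.mem_of_frob_lt (by omega))
  · obtain ⟨p, hp⟩ := Set.ncard_eq_one.1 h0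
    have hpS : p ∈ S := (hp ▸ Set.mem_singleton p : p ∈ minGens S).1
    rw [hp, ← Set.pair_eq_singleton] at hcl
    have := hS.coprime_of_mem_iff_mem_closure_pair hcl
    exact h1 ((Nat.coprime_self p).1 this ▸ hpS)

theorem IsNumericalSemigroup.two_mul_genus_le_of_embdim_eq_two {S : Set ℕ}
    (hS : IsNumericalSemigroup S) (hg : 1 ≤ genus S) (he : embdim S = 2) :
    2 * genus S ≤ frob S + 1 := by
  have one_lt : ∀ p ∈ minGens S, 1 < p := fun p hp => by
    have : p ≠ 1 := fun h => hS.one_notMem hg (h ▸ hp.1)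
    have := hp.2.1
    omega
  obtain ⟨p, q, -, hpq⟩ := Set.ncard_eq_two.1 he
  have hcl := hS.mem_iff_mem_closure_minGens
  refine hS.two_mul_genus_le_of_mem_iff_mem_closure_pair (hpq ▸ hcl) (one_lt p ?_) (one_lt q ?_)
    <;> simp [hpq]

theorem IsNumericalSemigroup.three_mul_genus_le {S : Set ℕ} (hS : IsNumericalSemigroup S)
    (hrefl : Reflective S) {s : ℕ} (hs : s ∈ S) (hs0 : 0 < s) (hsg : s < genus S) :
    3 * genus S ≤ 2 * (frob S + 1) := by
  have hdiv := Nat.div_add_mod (genus S - 1) s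
  have hmod := Nat.mod_lt (genus S - 1) hs0
  have hmul : s * 1 ≤ s * ((genus S - 1) / s) :=
    Nat.mul_le_mul_left s ((Nat.one_le_div_iff hs0).2 (by omega))
  have ha := hS.mul_mem hs ((genus S - 1) / s)
  rcases hrefl (s * ((genus S - 1) / s)) (by omega) with ⟨-, h⟩ | ⟨-, h⟩
  · have := hS.le_frob h
    omega
  · exact absurd ha h

/-- If `S` has no positive element below its genus, it is `{0} ∪ [g + 1, ∞)`. -/
theorem IsNumericalSemigroup.compl_eq_Icc_genus {S : Set ℕ} (hS : IsNumericalSemigroup S)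
    (h : ∀ s ∈ S, 0 < s → genus S < s) : Sᶜ = Set.Icc 1 (genus S) := by
  refine (Set.eq_of_subset_of_ncard_le (fun x hx hxS => ?_) ?_ hS.2.2).symm
  · exact absurd (h x hxS hx.1) (not_lt.2 hx.2)
  · simp [genus]

theorem IsNumericalSemigroup.genus_lt_embdim {S : Set ℕ} (hS : IsNumericalSemigroup S)
    (h : ∀ s ∈ S, 0 < s → genus S < s) : genus S < embdim S := by
  have hcompl := hS.compl_eq_Icc_genus h
  have hsub : Set.Icc (genus S + 1) (2 * genus S + 1) ⊆ minGens S := by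
    intro n hn
    rw [Set.mem_Icc] at hn
    refine ⟨?_, by omega, fun a ha b hb ha0 hb0 hab => ?_⟩
    · by_contra hnS
      have : n ∈ Set.Icc 1 (genus S) := hcompl ▸ hnS
      exact absurd this.2 (by omega)
    · have := h a ha (by omega)
      have := h b hb (by omega)
      omega
  have := Set.ncard_le_ncard hsub hS.finite_minGens
  rw [Set.ncard_Icc_nat] at this
  unfold embdim
  omega

theorem stmt16 (S : Set ℕ) (hS : IsNumericalSemigroup S) (hrefl : Reflective S)
    (hg : 1 ≤ genus S) :
    ((frob S : ℚ) + 1) / ((frob S : ℚ) + 1 - (genus S : ℚ)) ≤ (embdim S : ℚ) := by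
  have hgF := hS.genus_le_frob
  have hpos : (0 : ℚ) < (frob S : ℚ) + 1 - (genus S : ℚ) := by
    have : (genus S : ℚ) ≤ frob S := by exact_mod_cast hgF
    linarith
  rw [div_le_iff₀ hpos]
  obtain ⟨d, hd⟩ := Nat.exists_eq_add_of_le hgF
  suffices h : frob S + 1 ≤ embdim S * (d + 1) by
    have h' : (frob S : ℚ) + 1 ≤ embdim S * (d + 1) := by exact_mod_cast h
    have hd' : (frob S : ℚ) = genus S + d := by exact_mod_cast hd
    rw [show (frob S : ℚ) + 1 - genus S = d + 1 by linarith]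
    exact h'
  by_cases hsmall : ∃ s ∈ S, 0 < s ∧ s < genus S
  · obtain ⟨s, hs, hs0, hsg⟩ := hsmall
    rcases (hS.two_le_embdim hg).eq_or_lt with he | he
    · have := hS.two_mul_genus_le_of_embdim_eq_two hg he.symm
      rw [← he]
      omega
    · have := hS.three_mul_genus_le hrefl hs hs0 hsg
      have := Nat.mul_le_mul_right (d + 1) (show 3 ≤ embdim S from he)
      omega
  · have hgS : genus S ∉ S := by
      rcases hrefl 0 (by omega) with ⟨-, h⟩ | ⟨-, h⟩
      · simpa using h
      · exact absurd hS.1 h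
    have hlarge : ∀ s ∈ S, 0 < s → genus S < s := fun s hs hs0 =>
      lt_of_le_of_ne (not_lt.1 fun h => hsmall ⟨s, hs, hs0, h⟩) fun h => hgS (h ▸ hs)
    have hF : frob S = genus S := by
      rw [frob, hS.compl_eq_Icc_genus hlarge, csSup_Icc hg]
    have := hS.genus_lt_embdim hlarge
    have := Nat.mul_le_mul_left (embdim S) (show 1 ≤ d + 1 by omega)
    omega
end
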